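/- arXiv:2305.09973 — 2 statements merged into one kernel-verified Lean document; each statement's English description precedes it below -/
import Mathlib

section
/- Let U be an r×n matrix over F(ε) with full row rank, let B be the set of all size-r subsets S of [n] with det(U_S) ≠ 0, and define ω(S) = val(det(U_S)) for S ∈ B. Then ω is a matroid valuation: for all S, T ∈ B and every j ∈ T \ S, there exists k ∈ S \ T such that S−k+j ∈ B, T−j+k ∈ B, and ω(S) + ω(T) ≥ ω(S−k+j) + ω(T−j+k). -/
open Polynomial Matrix
open scoped Classical

/-- The ε-adic valuation on F(ε): `val(g/h) = mindeg g - mindeg h` for nonzero elements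
(`mindeg p = rootMultiplicity 0 p`), and `val 0 = +∞`. -/
noncomputable def rfval {F : Type*} [Field F] (f : RatFunc F) : WithTop ℤ :=
  if f = 0 then ⊤
  else (((f.num.rootMultiplicity 0 : ℤ) - (f.denom.rootMultiplicity 0 : ℤ) : ℤ) : WithTop ℤ)

/-- The submatrix of `U` consisting of the columns indexed by a size-`r` subset `S` of `[n]`
(taken in increasing order). -/
noncomputable def colSub {F : Type*} [Field F] {r n : ℕ} (U : Matrix (Fin r) (Fin n) (RatFunc F))
    (S : Finset (Fin n)) (h : S.card = r) : Matrix (Fin r) (Fin r) (RatFunc F) :=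
  U.submatrix id (fun j : Fin r => (S.orderIsoOfFin h j : Fin n))

/-- `S` is a base of the linear matroid represented by `U`: it has size `r` and the
corresponding r×r minor of `U` is nonzero. -/
noncomputable def isBase {F : Type*} [Field F] {r n : ℕ} (U : Matrix (Fin r) (Fin n) (RatFunc F))
    (S : Finset (Fin n)) : Prop :=
  ∃ h : S.card = r, (colSub U S h).det ≠ 0

/-- ω(S) = val(det(U_S)) (equal to +∞ when S is not a base, consistent with val(0) = +∞). -/
noncomputable def omegaVal {F : Type*} [Field F] {r n : ℕ}
    (U : Matrix (Fin r) (Fin n) (RatFunc F)) (S : Finset (Fin n)) : WithTop ℤ :=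
  if h : S.card = r then rfval (colSub U S h).det else ⊤

theorem rf_rm_ne {F : Type*} [Field F] (f : RatFunc F) (hf : f ≠ 0) :
    rfval f = (((f.num.rootMultiplicity 0 : ℤ) - (f.denom.rootMultiplicity 0 : ℤ) : ℤ) : WithTop ℤ) := by
  simp [rfval, hf]

theorem rfval_mul' {F : Type*} [Field F] (f g : RatFunc F) (hf : f ≠ 0) (hg : g ≠ 0) :
    rfval (f * g) = rfval f + rfval g := by
  have hfg : f * g ≠ 0 := mul_ne_zero hf hg
  rw [rf_rm_ne _ hf, rf_rm_ne _ hg, rf_rm_ne _ hfg, ← WithTop.coe_add]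
  have h := congrArg (Polynomial.rootMultiplicity 0) (RatFunc.num_denom_mul f g)
  have n1 := RatFunc.num_ne_zero hf
  have n2 := RatFunc.num_ne_zero hg
  have n3 := RatFunc.num_ne_zero hfg
  have d1 := RatFunc.denom_ne_zero f
  have d2 := RatFunc.denom_ne_zero g
  have d3 := RatFunc.denom_ne_zero (f * g)
  rw [Polynomial.rootMultiplicity_mul (by simp [*]), Polynomial.rootMultiplicity_mul (by simp [*]),
    Polynomial.rootMultiplicity_mul (by simp [*]), Polynomial.rootMultiplicity_mul (by simp [*])] at h
  congr 1
  omega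

theorem rfval_add' {F : Type*} [Field F] (f g : RatFunc F) (hf : f ≠ 0) (hg : g ≠ 0)
    (hfg : f + g ≠ 0) : rfval f ≤ rfval (f + g) ∨ rfval g ≤ rfval (f + g) := by
  rw [rf_rm_ne _ hf, rf_rm_ne _ hg, rf_rm_ne _ hfg, WithTop.coe_le_coe, WithTop.coe_le_coe]
  have h0 := RatFunc.num_denom_add f g
  have h := congrArg (Polynomial.rootMultiplicity 0) h0
  have n1 := RatFunc.num_ne_zero hf
  have n2 := RatFunc.num_ne_zero hg
  have n3 := RatFunc.num_ne_zero hfg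
  have d1 := RatFunc.denom_ne_zero f
  have d2 := RatFunc.denom_ne_zero g
  have d3 := RatFunc.denom_ne_zero (f + g)
  have hne : f.num * g.denom + f.denom * g.num ≠ 0 := by
    intro h1
    rw [h1, zero_mul] at h0
    simp [n3, d1, d2] at h0
  have hm := Polynomial.rootMultiplicity_add (a := 0) hne
  rw [Polynomial.rootMultiplicity_mul (by simp [*]), Polynomial.rootMultiplicity_mul (by simp [*]),
    Polynomial.rootMultiplicity_mul (mul_ne_zero hne d3)] at h
  rw [Polynomial.rootMultiplicity_mul (by simp [*]),
    Polynomial.rootMultiplicity_mul (by simp [*])] at hm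
  omega

theorem rfval_neg' {F : Type*} [Field F] (f : RatFunc F) : rfval (-f) = rfval f := by
  by_cases hf : f = 0
  · simp [hf]
  have h1 := rfval_mul' f f hf hf
  have h2 := rfval_mul' (-f) (-f) (neg_ne_zero.2 hf) (neg_ne_zero.2 hf)
  rw [neg_mul_neg, h1] at h2
  rw [rf_rm_ne _ hf, rf_rm_ne _ (neg_ne_zero.2 hf), ← WithTop.coe_add, ← WithTop.coe_add,
    WithTop.coe_inj] at h2
  rw [rf_rm_ne _ hf, rf_rm_ne _ (neg_ne_zero.2 hf)]
  congr 1
  omega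

theorem rfval_sum' {F : Type*} [Field F] {ι : Type*} (s : Finset ι) (f : ι → RatFunc F)
    (h : ∑ i ∈ s, f i ≠ 0) : ∃ i ∈ s, f i ≠ 0 ∧ rfval (f i) ≤ rfval (∑ i ∈ s, f i) := by
  induction s using Finset.induction_on with
  | empty => simp at h
  | insert a s ha ih =>
    rw [Finset.sum_insert ha] at h ⊢
    by_cases h1 : f a = 0
    · rw [h1, zero_add] at h ⊢
      obtain ⟨i, hi, h2⟩ := ih h
      exact ⟨i, Finset.mem_insert_of_mem hi, h2⟩
    by_cases h2 : ∑ i ∈ s, f i = 0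
    · exact ⟨a, Finset.mem_insert_self _ _, h1, by rw [h2, add_zero]⟩
    rcases rfval_add' _ _ h1 h2 h with h3 | h3
    · exact ⟨a, Finset.mem_insert_self _ _, h1, h3⟩
    · obtain ⟨i, hi, h4, h5⟩ := ih h2
      exact ⟨i, Finset.mem_insert_of_mem hi, h4, h5.trans h3⟩

theorem pluecker' {K : Type*} [Field K] {r n : ℕ} (U : Matrix (Fin r) (Fin n) K)
    (s t : Fin r → Fin n) (m : Fin r) :
    (U.submatrix id s).det * (U.submatrix id t).det =
      ∑ i, (U.submatrix id (Function.update s i (t m))).det *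
        (U.submatrix id (Function.update t m (s i))).det := by
  have key : ∀ (f : Fin r → Fin n) (i : Fin r) (k : Fin n),
      (U.submatrix id (Function.update f i k)).det =
        cramer (U.submatrix id f) (fun a => U a k) i := by
    intro f i k
    rw [cramer_apply]
    congr 1
    ext a b
    by_cases hb : b = i
    · subst hb; simp
    · simp [hb]
  have h1 := mulVec_cramer (U.submatrix id s) (fun a => U a (t m))
  have h2 := congrArg (fun v => cramer (U.submatrix id t) v m) h1
  have h3 : cramer (U.submatrix id t) (fun a => U a (t m)) m = (U.submatrix id t).det := by
    rw [← key]; simp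
  simp only [map_smul, Pi.smul_apply, smul_eq_mul, h3] at h2
  rw [← h2]
  have h4 : (U.submatrix id s) *ᵥ cramer (U.submatrix id s) (fun a => U a (t m)) =
      ∑ i, cramer (U.submatrix id s) (fun a => U a (t m)) i • (fun a => U a (s i)) := by
    ext a
    simp [mulVec, dotProduct, mul_comm]
  rw [h4, map_sum, Finset.sum_apply]
  simp [key]

theorem base_of {F : Type*} [Field F] {r n : ℕ} (U : Matrix (Fin r) (Fin n) (RatFunc F))
    (f : Fin r → Fin n) (S : Finset (Fin n)) (hd : (U.submatrix id f).det ≠ 0)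
    (hS : ∀ x, x ∈ S ↔ ∃ i, f i = x) :
    isBase U S ∧ omegaVal U S = rfval (U.submatrix id f).det := by
  have hf : Function.Injective f := by
    intro a b hab
    by_contra hne
    exact hd (det_zero_of_column_eq hne (fun i => by simp [hab]))
  have hSe : S = Finset.univ.image f := by ext x; simp [hS]
  have hc : S.card = r := by
    rw [hSe, Finset.card_image_of_injective _ hf]; simp
  let g : Fin r → Fin r := fun i => (S.orderIsoOfFin hc).symm ⟨f i, (hS _).2 ⟨i, rfl⟩⟩
  have hg : Function.Injective g := by
    intro a b hab
    have := (S.orderIsoOfFin hc).symm.injective hab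
    exact hf (congrArg Subtype.val this)
  let σ : Equiv.Perm (Fin r) := Equiv.ofBijective g (Finite.injective_iff_bijective.1 hg)
  have hfs : U.submatrix id f = (colSub U S hc).submatrix id σ := by
    ext a b
    have : ((S.orderIsoOfFin hc (g b) : S) : Fin n) = f b := by simp only [g, OrderIso.apply_symm_apply]
    change U a (f b) = U a ((S.orderIsoOfFin hc (g b) : S) : Fin n)
    rw [this]
  have hdet := det_permute' σ (colSub U S hc)
  rw [← hfs] at hdet
  have ho : omegaVal U S = rfval (colSub U S hc).det := by simp [omegaVal, hc]
  refine ⟨⟨hc, fun h => hd (by rw [hdet, h, mul_zero])⟩, ?_⟩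
  rw [ho, hdet]
  rcases Int.units_eq_one_or (Equiv.Perm.sign σ) with h | h
  · simp [h]
  · simp [h, rfval_neg']

/-- The function S ↦ val(det(U_S)) is a matroid valuation on the linear matroid represented
by a full-row-rank matrix U over F(ε): for bases S, T and j ∈ T \ S there is k ∈ S \ T with
S−k+j and T−j+k bases and ω(S) + ω(T) ≥ ω(S−k+j) + ω(T−j+k). -/
theorem val_det_is_matroid_valuation {F : Type*} [Field F] {r n : ℕ}
    (U : Matrix (Fin r) (Fin n) (RatFunc F)) (hU : U.rank = r)
    (S T : Finset (Fin n)) (hS : isBase U S) (hT : isBase U T)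
    (j : Fin n) (hj : j ∈ T \ S) :
    ∃ k ∈ S \ T,
      isBase U (insert j (S.erase k)) ∧ isBase U (insert k (T.erase j)) ∧
      omegaVal U (insert j (S.erase k)) + omegaVal U (insert k (T.erase j)) ≤
        omegaVal U S + omegaVal U T := by
  obtain ⟨hSc, hSd⟩ := hS
  obtain ⟨hTc, hTd⟩ := hT
  obtain ⟨hjT, hjS⟩ := Finset.mem_sdiff.1 hj
  have hoS : omegaVal U S = rfval (colSub U S hSc).det := by simp [omegaVal, hSc]
  have hoT : omegaVal U T = rfval (colSub U T hTc).det := by simp [omegaVal, hTc]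
  obtain ⟨s, hs⟩ : ∃ s : Fin r → Fin n, s = fun i => (S.orderIsoOfFin hSc i : Fin n) := ⟨_, rfl⟩
  obtain ⟨t, ht⟩ : ∃ t : Fin r → Fin n, t = fun i => (T.orderIsoOfFin hTc i : Fin n) := ⟨_, rfl⟩
  have hA : colSub U S hSc = U.submatrix id s := by rw [hs]; rfl
  have hB : colSub U T hTc = U.submatrix id t := by rw [ht]; rfl
  have hsS : ∀ x, x ∈ S ↔ ∃ i, s i = x := by
    intro x
    rw [hs]
    refine ⟨fun hx => ⟨(S.orderIsoOfFin hSc).symm ⟨x, hx⟩, by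
      simp only [OrderIso.apply_symm_apply]⟩, ?_⟩
    rintro ⟨i, rfl⟩
    exact (S.orderIsoOfFin hSc i).2
  have htT : ∀ x, x ∈ T ↔ ∃ i, t i = x := by
    intro x
    rw [ht]
    refine ⟨fun hx => ⟨(T.orderIsoOfFin hTc).symm ⟨x, hx⟩, by
      simp only [OrderIso.apply_symm_apply]⟩, ?_⟩
    rintro ⟨i, rfl⟩
    exact (T.orderIsoOfFin hTc i).2
  have hsi : Function.Injective s := by
    rw [hs]; exact Subtype.val_injective.comp (S.orderIsoOfFin hSc).injective
  have hti : Function.Injective t := by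
    rw [ht]; exact Subtype.val_injective.comp (T.orderIsoOfFin hTc).injective
  obtain ⟨m, hm⟩ := (htT j).1 hjT
  rw [hoS, hoT, ← rfval_mul' _ _ hSd hTd]
  have hne := mul_ne_zero hSd hTd
  rw [hA, hB] at hne ⊢
  have hp := pluecker' U s t m
  rw [hp] at hne ⊢
  obtain ⟨i, -, hi0, hi⟩ := rfval_sum' _ _ hne
  have hne1 := left_ne_zero_of_mul hi0
  have hne2 := right_ne_zero_of_mul hi0
  have hsiS : s i ∈ S := (hsS _).2 ⟨i, rfl⟩
  have hsj : s i ≠ j := fun h => hjS (h ▸ hsiS)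
  have hupd : ∀ (f : Fin r → Fin n) (hf : Function.Injective f) (P : Finset (Fin n))
      (_ : ∀ x, x ∈ P ↔ ∃ i, f i = x) (a : Fin r) (b : Fin n) (x : Fin n),
      x ∈ insert b (P.erase (f a)) ↔ ∃ i, Function.update f a b i = x := by
    intro f hf P hP a b x
    rw [Finset.mem_insert, Finset.mem_erase, hP]
    constructor
    · rintro (rfl | ⟨h1, c, rfl⟩)
      · exact ⟨a, by simp⟩
      · have : c ≠ a := fun h => h1 (by rw [h])
        exact ⟨c, by simp [this]⟩
    · rintro ⟨c, rfl⟩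
      by_cases hc : c = a
      · left; simp [hc]
      · right; simp [hc, hf.eq_iff]
  have hsT : s i ∉ T := by
    intro h
    obtain ⟨c, hc⟩ := (htT _).1 h
    have hcm : c ≠ m := by
      rintro rfl
      exact hsj (hc.symm.trans hm)
    exact hne2 (det_zero_of_column_eq hcm (fun a => by simp [hcm, hc]))
  rw [hm] at hne1
  obtain ⟨b1, o1⟩ := base_of U _ (insert j (S.erase (s i))) hne1 (hupd s hsi S hsS i j)
  obtain ⟨b2, o2⟩ := base_of U _ (insert (s i) (T.erase j)) hne2
    (hm ▸ hupd t hti T htT m (s i))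
  refine ⟨s i, Finset.mem_sdiff.2 ⟨hsiS, hsT⟩, b1, b2, ?_⟩
  rw [o1, o2, ← rfval_mul' _ _ hne1 hne2]
  rw [hm] at hi ⊢
  exact hi
end

section
/- Main closure theorem (affine case): Let A_0, A_1, …, A_n ∈ F(ε)^{r×r} with rank(A_i) = 1 over F(ε) for 1 ≤ i ≤ n, and suppose f = lim_{ε→0} det(A_0 + Σ_{i=1}^n A_i x_i) exists. Then there exist matrices B_0, B_1, …, B_n ∈ F^{(n+r)×(n+r)} with rank(B_i) = 1 for each i ∈ [n] such that f = det(B_0 + Σ_{i=1}^n B_i x_i). -/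
open Polynomial Matrix MvPolynomial
open scoped Classical

/-- `lim_{ε→0} f` exists iff `f` has no pole at ε = 0, i.e. val(f) ≥ 0. -/
def rfHasLim {F : Type*} [Field F] (f : RatFunc F) : Prop := 0 ≤ rfval f

/-- The value of `f` at ε = 0 (the limit of `f` at 0, when it exists). -/
noncomputable def rfLim {F : Type*} [Field F] (f : RatFunc F) : F :=
  f.eval (RingHom.id F) 0


theorem rado_pairs {k V ι : Type*} [Field k] [AddCommGroup V] [Module k V] [FiniteDimensional k V]
    [Fintype ι] [DecidableEq ι] (T : Finset ι) :
    ∀ (p q : ι → V), (∀ i ∉ T, p i = q i) →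
    (∀ J : Finset ι, J.card ≤ Module.finrank k (Submodule.span k (p '' J ∪ q '' J))) →
    ∃ S : Finset ι, LinearIndependent k (fun i => if i ∈ S then p i else q i) := by
  induction T using Finset.induction_on with
  | empty =>
    intro p q hpq h
    refine ⟨∅, ?_⟩
    have hpq' : p = q := funext fun i => hpq i (by simp)
    subst hpq'
    simp only [Finset.notMem_empty, if_false]
    rw [linearIndependent_iff_card_le_finrank_span]
    have := h Finset.univ
    rw [Set.union_self, Finset.coe_univ, Set.image_univ] at this
    simpa [Set.finrank] using this
  | insert a T ha ih =>
    intro p q hpq h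
    by_cases h1 : ∀ J : Finset ι, J.card ≤ Module.finrank k (Submodule.span k
        (p '' J ∪ (Function.update q a (p a)) '' J))
    · obtain ⟨S, hS⟩ := ih p (Function.update q a (p a)) (by
        intro i hi
        by_cases hia : i = a
        · subst hia; simp
        · rw [Function.update_of_ne hia]
          exact hpq i (by simp [hia, hi])) h1
      refine ⟨insert a S, ?_⟩
      convert hS using 2 with i
      by_cases hia : i = a
      · subst hia; simp
      · simp [hia]
    by_cases h2 : ∀ J : Finset ι, J.card ≤ Module.finrank k (Submodule.span k
        ((Function.update p a (q a)) '' J ∪ q '' J))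
    · obtain ⟨S, hS⟩ := ih (Function.update p a (q a)) q (by
        intro i hi
        by_cases hia : i = a
        · subst hia; simp
        · rw [Function.update_of_ne hia]
          exact hpq i (by simp [hia, hi])) h2
      refine ⟨S.erase a, ?_⟩
      convert hS using 2 with i
      by_cases hia : i = a
      · subst hia; simp
      · simp [hia]
    exfalso
    push Not at h1 h2
    obtain ⟨J1, hJ1⟩ := h1
    obtain ⟨J2, hJ2⟩ := h2
    have ha1 : a ∈ J1 := by
      by_contra hc
      refine absurd (h J1) (not_le.mpr ?_)
      have : (Function.update q a (p a)) '' J1 = q '' J1 := by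
        apply Set.image_congr
        intro i hi
        rw [Function.update_of_ne]
        rintro rfl
        exact hc hi
      rwa [this] at hJ1
    have ha2 : a ∈ J2 := by
      by_contra hc
      refine absurd (h J2) (not_le.mpr ?_)
      have : (Function.update p a (q a)) '' J2 = p '' J2 := by
        apply Set.image_congr
        intro i hi
        rw [Function.update_of_ne]
        rintro rfl
        exact hc hi
      rwa [this] at hJ2
    set X := Submodule.span k (p '' J1 ∪ (Function.update q a (p a)) '' J1) with hX
    set Y := Submodule.span k ((Function.update p a (q a)) '' J2 ∪ q '' J2) with hY
    have pX : ∀ i ∈ J1, p i ∈ X := fun i hi => Submodule.subset_span (Or.inl ⟨i, hi, rfl⟩)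
    have qX : ∀ i ∈ J1, i ≠ a → q i ∈ X := fun i hi hia =>
      Submodule.subset_span (Or.inr ⟨i, hi, by simp [hia]⟩)
    have qY : ∀ i ∈ J2, q i ∈ Y := fun i hi => Submodule.subset_span (Or.inr ⟨i, hi, rfl⟩)
    have pY : ∀ i ∈ J2, i ≠ a → p i ∈ Y := fun i hi hia =>
      Submodule.subset_span (Or.inl ⟨i, hi, by simp [hia]⟩)
    have hsup : Submodule.span k (p '' ↑(J1 ∪ J2) ∪ q '' ↑(J1 ∪ J2)) ≤ X ⊔ Y := by
      rw [Submodule.span_le]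
      rintro _ (⟨i, hi, rfl⟩ | ⟨i, hi, rfl⟩)
      · by_cases hia : i = a
        · subst hia; exact (le_sup_left : X ≤ X ⊔ Y) (pX _ ha1)
        rcases Finset.mem_union.1 (Finset.mem_coe.1 hi) with h' | h'
        · exact (le_sup_left : X ≤ X ⊔ Y) (pX _ h')
        · exact (le_sup_right : Y ≤ X ⊔ Y) (pY _ h' hia)
      · by_cases hia : i = a
        · subst hia; exact (le_sup_right : Y ≤ X ⊔ Y) (qY _ ha2)
        rcases Finset.mem_union.1 (Finset.mem_coe.1 hi) with h' | h'
        · exact (le_sup_left : X ≤ X ⊔ Y) (qX _ h' hia)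
        · exact (le_sup_right : Y ≤ X ⊔ Y) (qY _ h')
    have hinf : Submodule.span k (p '' ↑((J1 ∩ J2).erase a) ∪ q '' ↑((J1 ∩ J2).erase a)) ≤
        X ⊓ Y := by
      rw [Submodule.span_le]
      rintro _ (⟨i, hi, rfl⟩ | ⟨i, hi, rfl⟩) <;>
      · have hi' := Finset.mem_coe.1 hi
        rw [Finset.mem_erase, Finset.mem_inter] at hi'
        obtain ⟨hia, h1, h2⟩ := hi'
        first
          | exact ⟨pX _ h1, pY _ h2 hia⟩
          | exact ⟨qX _ h1 hia, qY _ h2⟩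
    have e1 := (h _).trans (Submodule.finrank_mono hsup)
    have e2 := (h _).trans (Submodule.finrank_mono hinf)
    have e3 := Submodule.finrank_sup_add_finrank_inf_eq X Y
    have e4 := Finset.card_union_add_card_inter J1 J2
    rw [Finset.card_erase_of_mem (Finset.mem_inter.2 ⟨ha1, ha2⟩)] at e2
    omega

theorem rado_block {k ι : Type*} [Field k] [Fintype ι] [DecidableEq ι] (p q : ι → ι → k)
    (hdep : ∀ S : Finset ι, ¬ LinearIndependent k (fun i => if i ∈ S then p i else q i)) :
    ∃ (J C : Finset ι) (h : Matrix ι ι k), C.card + 1 = J.card ∧ h.det ≠ 0 ∧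
      ∀ i ∈ J, ∀ j ∉ C, (p i ᵥ* h) j = 0 ∧ (q i ᵥ* h) j = 0 := by
  have : ∃ J : Finset ι, Module.finrank k (Submodule.span k (p '' J ∪ q '' J)) < J.card := by
    by_contra hc
    push Not at hc
    obtain ⟨S, hS⟩ := rado_pairs Finset.univ p q (by simp) hc
    exact hdep S hS
  obtain ⟨J, hJ⟩ := this
  set W := Submodule.span k (p '' J ∪ q '' J) with hW
  let w := Module.finBasis k W
  have hw : LinearIndependent k (fun i => (w i : ι → k)) :=
    w.linearIndependent.map' W.subtype (Submodule.ker_subtype W)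
  let b0 := Module.Basis.sumExtend hw
  let e := b0.indexEquiv (Pi.basisFun k ι)
  let b := b0.reindex e
  let C0 : Finset ι := Finset.univ.image (fun i => e (Sum.inl i))
  have hC0 : C0.card ≤ J.card - 1 := by
    refine Finset.card_image_le.trans ?_
    simp only [Finset.card_univ, Fintype.card_fin]
    omega
  obtain ⟨C, hC0C, hC⟩ := Finset.exists_superset_card_eq hC0
    (le_trans (Nat.sub_le _ _) (Finset.card_le_univ J))
  have hWC : ∀ x ∈ W, ∀ j ∉ C, b.repr x j = 0 := by
    intro x hx j hj
    have hx' : x ∈ Submodule.span k (b '' (C0 : Set ι)) := by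
      have h1 : x = ∑ i, w.repr ⟨x, hx⟩ i • (w i : ι → k) := by
        have := congrArg Subtype.val (w.sum_repr ⟨x, hx⟩)
        refine this.symm.trans ?_
        simp only [AddSubmonoidClass.coe_finsetSum, Submodule.coe_smul]
      rw [h1]
      refine Submodule.sum_mem _ fun i _ => Submodule.smul_mem _ _ (Submodule.subset_span ?_)
      refine ⟨e (Sum.inl i), by simp [C0], ?_⟩
      simp only [b, Module.Basis.reindex_apply, Equiv.symm_apply_apply]
      simp [b0, Module.Basis.sumExtend]
      rfl
    rw [Module.Basis.mem_span_image] at hx'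
    by_contra hne
    exact hj (hC0C (hx' (by simpa using hne)))
  refine ⟨J, C, (b.toMatrix (Pi.basisFun k ι))ᵀ, by omega, ?_, ?_⟩
  · rw [Matrix.det_transpose]
    have := congrArg Matrix.det (Module.Basis.toMatrix_mul_toMatrix_flip b (Pi.basisFun k ι))
    rw [Matrix.det_mul, Matrix.det_one] at this
    exact left_ne_zero_of_mul_eq_one this
  · have key : ∀ x : ι → k, x ᵥ* (b.toMatrix (Pi.basisFun k ι))ᵀ = b.repr x := by
      intro x
      rw [Matrix.vecMul_transpose]
      have := Module.Basis.toMatrix_mulVec_repr (Pi.basisFun k ι) b x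
      rw [← this]
      congr 1
    intro i hi j hj
    rw [key, key]
    exact ⟨hWC _ (Submodule.subset_span (Or.inl ⟨i, hi, rfl⟩)) j hj,
      hWC _ (Submodule.subset_span (Or.inr ⟨i, hi, rfl⟩)) j hj⟩


theorem denom_eval_ne_zero_of_rfHasLim {F : Type*} [Field F] {c : RatFunc F} (h : rfHasLim c) :
    c.denom.eval 0 ≠ 0 := by
  intro h0
  by_cases hc : c = 0
  · subst hc; simp at h0
  rw [rfHasLim, rfval, if_neg hc] at h
  have h' : (0 : ℤ) ≤ (c.num.rootMultiplicity 0 : ℤ) - (c.denom.rootMultiplicity 0 : ℤ) := by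
    exact_mod_cast h
  have h1 : 0 < c.denom.rootMultiplicity 0 :=
    (Polynomial.rootMultiplicity_pos c.denom_ne_zero).2 h0
  have h2 : 0 < c.num.rootMultiplicity 0 := by omega
  have h3 : c.num.eval 0 = 0 :=
    (Polynomial.rootMultiplicity_pos (RatFunc.num_ne_zero hc)).1 h2
  obtain ⟨u, v, huv⟩ := RatFunc.isCoprime_num_denom c
  have := congrArg (Polynomial.eval 0) huv
  simp [h0, h3] at this

theorem eval_mul_rfLim {F : Type*} [Field F] {c : RatFunc F} (h : rfHasLim c)
    (b g : Polynomial F)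
    (hbg : algebraMap (Polynomial F) (RatFunc F) b * c = algebraMap (Polynomial F) (RatFunc F) g) :
    b.eval 0 * rfLim c = g.eval 0 := by
  have hd := denom_eval_ne_zero_of_rfHasLim h
  have hd' : algebraMap (Polynomial F) (RatFunc F) c.denom ≠ 0 :=
    RatFunc.algebraMap_ne_zero c.denom_ne_zero
  have h1 : b * c.num = g * c.denom := by
    apply RatFunc.algebraMap_injective F
    rw [map_mul, map_mul, ← hbg]
    have h3 : algebraMap (Polynomial F) (RatFunc F) c.num =
        c * algebraMap (Polynomial F) (RatFunc F) c.denom := by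
      rw [← div_eq_iff hd']
      exact RatFunc.num_div_denom c
    rw [h3, mul_assoc]
  have h2 := congrArg (Polynomial.eval 0) h1
  rw [Polynomial.eval_mul, Polynomial.eval_mul] at h2
  rw [rfLim, RatFunc.eval]
  change b.eval 0 * (c.num.eval 0 / c.denom.eval 0) = _
  rw [← mul_div_assoc, h2, mul_div_assoc, div_self hd, mul_one]

/-- The determinant of the matrix whose row `inl i` is `Q i + x_i P i` and whose row `inr j` is
`Q j`. -/
noncomputable def symDet {R : Type*} [CommRing R] {n r : ℕ}
    (P Q : Matrix (Fin n ⊕ Fin r) (Fin n ⊕ Fin r) R) : MvPolynomial (Fin n) R :=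
  Matrix.det (Matrix.of fun i j => MvPolynomial.C (Q i j) +
    Sum.elim (MvPolynomial.X : Fin n → MvPolynomial (Fin n) R) 0 i * MvPolynomial.C (P i j))

theorem map_symDet {R S : Type*} [CommRing R] [CommRing S] (φ : R →+* S) {n r : ℕ}
    (P Q : Matrix (Fin n ⊕ Fin r) (Fin n ⊕ Fin r) R) :
    MvPolynomial.map φ (symDet P Q) = symDet (P.map φ) (Q.map φ) := by
  rw [symDet, RingHom.map_det, symDet]
  congr 1
  ext1 i j
  rcases i with i | i <;> simp

theorem symDet_smul {R : Type*} [CommRing R] {n r : ℕ}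
    (P Q : Matrix (Fin n ⊕ Fin r) (Fin n ⊕ Fin r) R) (b : R) :
    symDet (b • P) (b • Q) = MvPolynomial.C (b ^ (n + r)) * symDet P Q := by
  have : Fintype.card (Fin n ⊕ Fin r) = n + r := by simp
  rw [symDet, symDet, map_pow, ← this, ← Matrix.det_smul]
  congr 1
  ext1 i j
  simp only [Matrix.of_apply, Matrix.smul_apply, smul_eq_mul, map_mul]
  ring

theorem symDet_mul {R : Type*} [CommRing R] {n r : ℕ}
    (P Q P' Q' h : Matrix (Fin n ⊕ Fin r) (Fin n ⊕ Fin r) R) (d1 d2 : Fin n ⊕ Fin r → R)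
    (hP : ∀ i j, P' i j * d2 j = d1 i * (P * h) i j)
    (hQ : ∀ i j, Q' i j * d2 j = d1 i * (Q * h) i j) :
    symDet P' Q' * MvPolynomial.C (∏ i, d2 i) =
      MvPolynomial.C (∏ i, d1 i) * (symDet P Q * MvPolynomial.C h.det) := by
  have key : (Matrix.of fun i j => MvPolynomial.C (Q' i j) +
      Sum.elim (MvPolynomial.X : Fin n → MvPolynomial (Fin n) R) 0 i * MvPolynomial.C (P' i j)) *
      Matrix.diagonal (fun j => MvPolynomial.C (d2 j)) =
      Matrix.diagonal (fun j => MvPolynomial.C (d1 j)) * ((Matrix.of fun i j =>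
        MvPolynomial.C (Q i j) +
      Sum.elim (MvPolynomial.X : Fin n → MvPolynomial (Fin n) R) 0 i * MvPolynomial.C (P i j)) *
        h.map MvPolynomial.C) := by
    ext1 i j
    rw [Matrix.mul_diagonal, Matrix.diagonal_mul]
    simp only [Matrix.of_apply, Matrix.mul_apply, Matrix.map_apply, add_mul, Finset.sum_add_distrib]
    have e1 := congrArg (MvPolynomial.C (σ := Fin n)) (hP i j)
    have e2 := congrArg (MvPolynomial.C (σ := Fin n)) (hQ i j)
    simp only [Matrix.mul_apply, map_mul, map_sum] at e1 e2
    rw [mul_assoc, e1, e2, mul_add]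
    simp only [mul_assoc, ← Finset.mul_sum]
    ring
  have := congrArg Matrix.det key
  rw [Matrix.det_mul, Matrix.det_mul, Matrix.det_mul, Matrix.det_diagonal,
    Matrix.det_diagonal] at this
  rw [symDet, symDet, map_prod, map_prod, this, RingHom.map_det]
  rfl

/-- If the symbolic determinant vanishes, every transversal is dependent. -/
theorem dep_of_symDet_eq_zero {F : Type*} [Field F] {n r : ℕ}
    (P Q : Matrix (Fin n ⊕ Fin r) (Fin n ⊕ Fin r) F) (hP : ∀ j, P (Sum.inr j) = 0)
    (h0 : symDet P Q = 0) (S : Finset (Fin n ⊕ Fin r)) :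
    ¬ LinearIndependent F (fun i => if i ∈ S then P i + Q i else Q i) := by
  intro hli
  have h1 := congrArg (MvPolynomial.eval (fun i : Fin n => if Sum.inl i ∈ S then (1 : F) else 0)) h0
  rw [symDet, RingHom.map_det, map_zero] at h1
  have h2 : IsUnit (Matrix.of (fun i => if i ∈ S then P i + Q i else Q i)) :=
    Matrix.linearIndependent_rows_iff_isUnit.1 hli
  rw [Matrix.isUnit_iff_isUnit_det] at h2
  apply h2.ne_zero
  rw [← h1]
  congr 1
  ext i j
  rcases i with i | i
  · by_cases hi : Sum.inl i ∈ S <;> simp [hi, add_comm]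
  · by_cases hi : Sum.inr i ∈ S <;> simp [hi, hP]

theorem symDet_step {F : Type*} [Field F] {n r : ℕ}
    (P Q : Matrix (Fin n ⊕ Fin r) (Fin n ⊕ Fin r) (Polynomial F)) (hP : ∀ j, P (Sum.inr j) = 0)
    (h0 : MvPolynomial.map (Polynomial.evalRingHom 0) (symDet P Q) = 0) :
    ∃ (P' Q' : Matrix (Fin n ⊕ Fin r) (Fin n ⊕ Fin r) (Polynomial F)) (u : F), u ≠ 0 ∧
      (∀ j, P' (Sum.inr j) = 0) ∧
      symDet P' Q' * MvPolynomial.C Polynomial.X =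
        symDet P Q * MvPolynomial.C (Polynomial.C u) := by
  rw [map_symDet] at h0
  obtain ⟨J, C, h, hJC, hdet, hz⟩ := rado_block _ _ (dep_of_symDet_eq_zero _ _
    (fun j => by ext k; simp [hP]) h0)
  let H : Matrix (Fin n ⊕ Fin r) (Fin n ⊕ Fin r) (Polynomial F) := h.map Polynomial.C
  let N : Matrix (Fin n ⊕ Fin r) (Fin n ⊕ Fin r) (Polynomial F) →
      Matrix (Fin n ⊕ Fin r) (Fin n ⊕ Fin r) (Polynomial F) := fun P => Matrix.of fun i j =>
      if i ∈ J then (if j ∈ C then (P * H) i j else ((P * H) i j).divX)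
      else (if j ∈ C then Polynomial.X * (P * H) i j else (P * H) i j)
  have hN : ∀ R : Matrix (Fin n ⊕ Fin r) (Fin n ⊕ Fin r) (Polynomial F),
      (∀ i ∈ J, ∀ j ∉ C, ((R.map (Polynomial.evalRingHom 0)) i ᵥ* h) j = 0) →
      ∀ i j, N R i j * (if j ∈ C then 1 else Polynomial.X) =
        (if i ∈ J then 1 else Polynomial.X) * (R * H) i j := by
    intro R hR i j
    by_cases hi : i ∈ J
    · by_cases hj : j ∈ C
      · simp [N, hi, hj]
      · simp only [N, hi, hj, Matrix.of_apply, if_true, if_false, one_mul]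
        have : ((R * H) i j).coeff 0 = 0 := by
          refine Eq.trans ?_ (hR i hi j hj)
          rw [Polynomial.coeff_zero_eq_eval_zero, Matrix.mul_apply,
            Polynomial.eval_finsetSum]
          simp [Matrix.vecMul, dotProduct, H]
        conv_rhs => rw [← Polynomial.divX_mul_X_add ((R * H) i j), this]
        simp
    · by_cases hj : j ∈ C
      · simp [N, hi, hj]
      · simp [N, hi, hj, mul_comm]
  have hQz : ∀ i ∈ J, ∀ j ∉ C, ((Q.map (Polynomial.evalRingHom 0)) i ᵥ* h) j = 0 :=
    fun i hi j hj => (hz i hi j hj).2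
  have hPz : ∀ i ∈ J, ∀ j ∉ C, ((P.map (Polynomial.evalRingHom 0)) i ᵥ* h) j = 0 := by
    intro i hi j hj
    have := (hz i hi j hj).1
    rw [Matrix.add_vecMul, Pi.add_apply, hQz i hi j hj, add_zero] at this
    exact this
  have key := symDet_mul P Q (N P) (N Q) H _ _ (hN P hPz) (hN Q hQz)
  refine ⟨N P, N Q, h.det, hdet, ?_, ?_⟩
  · intro j
    have : ∀ k, (P * H) (Sum.inr j) k = 0 := by
      intro k
      rw [Matrix.mul_apply]
      simp [hP]
    ext1 k
    simp [N, this]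
  · have hc : ∀ S : Finset (Fin n ⊕ Fin r), (∏ i, if i ∈ S then (1 : Polynomial F) else
        Polynomial.X) = Polynomial.X ^ (n + r - S.card) := by
      intro S
      rw [Finset.prod_ite, Finset.prod_const_one, one_mul, Finset.prod_const]
      congr 1
      rw [Finset.filter_not, Finset.card_sdiff]
      simp
    have hJ : J.card ≤ n + r := by
      simpa using Finset.card_le_univ J
    rw [hc, hc, show n + r - C.card = (n + r - J.card) + 1 by omega, pow_succ', map_mul,
      ← mul_assoc, mul_comm (MvPolynomial.C (Polynomial.X ^ _))] at key
    have hH : H.det = Polynomial.C h.det := (RingHom.map_det Polynomial.C h).symm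
    rw [hH] at key
    refine mul_right_cancel₀ ?_ key
    rw [Ne, MvPolynomial.C_eq_zero]
    exact pow_ne_zero _ Polynomial.X_ne_zero

theorem symDet_limit {F : Type*} [Field F] {n r : ℕ} (f : MvPolynomial (Fin n) (RatFunc F))
    (hf : ∀ d, rfHasLim (MvPolynomial.coeff d f)) (m : ℕ) :
    ∀ (P Q : Matrix (Fin n ⊕ Fin r) (Fin n ⊕ Fin r) (Polynomial F)) (b : Polynomial F),
      (∀ j, P (Sum.inr j) = 0) → b.eval 0 ≠ 0 →
      MvPolynomial.C (algebraMap (Polynomial F) (RatFunc F) (Polynomial.X ^ m * b)) * f =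
        MvPolynomial.map (algebraMap (Polynomial F) (RatFunc F)) (symDet P Q) →
      ∃ (P' Q' : Matrix (Fin n ⊕ Fin r) (Fin n ⊕ Fin r) F) (u : F), u ≠ 0 ∧
        (∀ j, P' (Sum.inr j) = 0) ∧
        ∀ d, u * rfLim (MvPolynomial.coeff d f) = MvPolynomial.coeff d (symDet P' Q') := by
  induction m with
  | zero =>
    intro P Q b hP hb h
    refine ⟨P.map (Polynomial.evalRingHom 0), Q.map (Polynomial.evalRingHom 0), b.eval 0, hb,
      fun j => by ext k; simp [hP], fun d => ?_⟩
    have h1 := congrArg (MvPolynomial.coeff d) h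
    rw [MvPolynomial.coeff_C_mul, MvPolynomial.coeff_map, pow_zero, one_mul] at h1
    rw [eval_mul_rfLim (hf d) _ _ h1, ← map_symDet, MvPolynomial.coeff_map]
    rfl
  | succ m ih =>
    intro P Q b hP hb h
    have h0 : MvPolynomial.map (Polynomial.evalRingHom 0) (symDet P Q) = 0 := by
      ext d
      have h1 := congrArg (MvPolynomial.coeff d) h
      rw [MvPolynomial.coeff_C_mul, MvPolynomial.coeff_map] at h1
      rw [MvPolynomial.coeff_map, MvPolynomial.coeff_zero, Polynomial.coe_evalRingHom,
        ← eval_mul_rfLim (hf d) _ _ h1]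
      simp
    obtain ⟨P', Q', u, hu, hP', hs⟩ := symDet_step P Q hP h0
    refine ih P' Q' (b * Polynomial.C u) hP' (by simp [hb, hu]) ?_
    have hs' := congrArg (MvPolynomial.map (algebraMap (Polynomial F) (RatFunc F))) hs
    rw [map_mul, map_mul, ← h, MvPolynomial.map_C, MvPolynomial.map_C] at hs'
    have hX : (MvPolynomial.C (algebraMap (Polynomial F) (RatFunc F) Polynomial.X) :
        MvPolynomial (Fin n) (RatFunc F)) ≠ 0 := by
      rw [Ne, MvPolynomial.C_eq_zero]
      exact RatFunc.algebraMap_ne_zero Polynomial.X_ne_zero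
    refine mul_right_cancel₀ hX ?_
    rw [hs']
    simp only [map_mul, map_pow, pow_succ]
    ring


theorem exists_vecMulVec_of_rank_one {K : Type*} [Field K] {r : ℕ} (A : Matrix (Fin r) (Fin r) K)
    (hA : A.rank = 1) : ∃ u v : Fin r → K, ∀ i j, A i j = u i * v j := by
  rw [Matrix.rank_eq_finrank_span_row] at hA
  obtain ⟨v, hv⟩ := finrank_le_one_iff.1 hA.le
  have : ∀ i, ∃ c : K, ∀ j, A i j = c * v.1 j := by
    intro i
    obtain ⟨c, hc⟩ := hv ⟨A i, Submodule.subset_span ⟨i, rfl⟩⟩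
    refine ⟨c, fun j => ?_⟩
    have := congrFun (congrArg Subtype.val hc) j
    simpa using this.symm
  choose u hu using this
  exact ⟨u, v.1, hu⟩

theorem rank_rowMatrix {K ι : Type*} [Field K] [Fintype ι] [DecidableEq ι] (a : ι) (p : ι → K)
    (hp : p ≠ 0) : (Matrix.vecMulVec (Pi.single a 1) p : Matrix ι ι K).rank = 1 := by
  refine le_antisymm (Matrix.rank_vecMulVec_le _ _) ?_
  rw [Nat.one_le_iff_ne_zero]
  intro h0
  rw [Matrix.rank, Module.finrank_zero_iff, Submodule.subsingleton_iff_eq_bot,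
    LinearMap.range_eq_bot] at h0
  apply hp
  ext j
  have := congrFun (LinearMap.congr_fun h0 (Pi.single j 1)) a
  simpa [Matrix.vecMulVec_apply] using this

/-- A symbolic determinant with nonzero linear rows is a determinant of the required form. -/
theorem symDet_realize {F : Type*} [Field F] {n r : ℕ}
    (P Q : Matrix (Fin n ⊕ Fin r) (Fin n ⊕ Fin r) F) (hP : ∀ i, P (Sum.inl i) ≠ 0) :
    ∃ (B0 : Matrix (Fin (n + r)) (Fin (n + r)) F)
      (B : Fin n → Matrix (Fin (n + r)) (Fin (n + r)) F),
      (∀ i, (B i).rank = 1) ∧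
      symDet P Q = (B0.map (MvPolynomial.C : F →+* _) +
            ∑ i : Fin n, (MvPolynomial.X i : MvPolynomial (Fin n) F) •
              ((B i).map (MvPolynomial.C : F →+* _))).det := by
  refine ⟨Q.submatrix finSumFinEquiv.symm finSumFinEquiv.symm, fun i =>
    (Matrix.vecMulVec (Pi.single (Sum.inl i) 1) (P (Sum.inl i)) : Matrix _ _ F).submatrix
      finSumFinEquiv.symm finSumFinEquiv.symm, fun i => ?_, ?_⟩
  · rw [Matrix.rank_submatrix, rank_rowMatrix _ _ (hP i)]
  · rw [symDet, ← Matrix.det_submatrix_equiv_self finSumFinEquiv.symm]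
    congr 1
    ext1 a b
    simp only [Matrix.submatrix_apply, Matrix.of_apply, Matrix.add_apply, Matrix.map_apply,
      Matrix.sum_apply, Matrix.smul_apply, Matrix.vecMulVec_apply, smul_eq_mul]
    congr 1
    generalize finSumFinEquiv.symm a = a'
    generalize finSumFinEquiv.symm b = b'
    rcases a' with a' | a'
    · rw [Finset.sum_eq_single a']
      · simp
      · intro i _ hi
        have : (Sum.inl a' : Fin n ⊕ Fin r) ≠ Sum.inl i := fun h => hi (Sum.inl_injective h).symm
        simp [Pi.single_apply, this]
      · simp
    · simp [Pi.single_apply]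

theorem symDet_initial {K : Type*} [Field K] {n r : ℕ} (A0 : Matrix (Fin r) (Fin r) K)
    (A : Fin n → Matrix (Fin r) (Fin r) K) (hA : ∀ i, (A i).rank = 1) :
    ∃ P Q : Matrix (Fin n ⊕ Fin r) (Fin n ⊕ Fin r) K, (∀ j, P (Sum.inr j) = 0) ∧
      symDet P Q = (A0.map (MvPolynomial.C : K →+* _) +
          ∑ i : Fin n, (MvPolynomial.X i : MvPolynomial (Fin n) K) •
            ((A i).map (MvPolynomial.C : K →+* _))).det := by
  choose u v huv using fun i => exists_vecMulVec_of_rank_one (A i) (hA i)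
  refine ⟨Matrix.fromBlocks 0 (Matrix.of fun i k => - v i k) 0 0,
    Matrix.fromBlocks 1 0 (Matrix.of fun j i => u i j) A0, ?_, ?_⟩
  · intro j
    ext k
    rcases k with k | k <;> simp
  · have : (Matrix.of fun i j => MvPolynomial.C ((Matrix.fromBlocks (1 : Matrix (Fin n) (Fin n) K) 0
        (Matrix.of fun j i => u i j) A0) i j) +
        Sum.elim (MvPolynomial.X : Fin n → MvPolynomial (Fin n) K) 0 i * MvPolynomial.C
        ((Matrix.fromBlocks (0 : Matrix (Fin n) (Fin n) K) (Matrix.of fun i k => - v i k) 0 0) i j)) =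
        Matrix.fromBlocks 1 (Matrix.of fun i k => - (MvPolynomial.X i * MvPolynomial.C (v i k)))
          (Matrix.of fun j i => MvPolynomial.C (u i j)) (A0.map MvPolynomial.C) := by
      ext1 i j
      rcases i with i | i <;> rcases j with j | j <;> simp [Matrix.one_apply]
    rw [symDet, this, Matrix.det_fromBlocks_one₁₁]
    congr 1
    ext1 i j
    simp only [Matrix.sub_apply, Matrix.add_apply, Matrix.mul_apply, Matrix.of_apply,
      Matrix.sum_apply, Matrix.smul_apply, Matrix.map_apply, smul_eq_mul, huv, map_mul,
      sub_eq_add_neg, ← Finset.sum_neg_distrib]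
    congr 1
    refine Finset.sum_congr rfl fun k _ => ?_
    ring

theorem symDet_clear {F : Type*} [Field F] {n r : ℕ}
    (P Q : Matrix (Fin n ⊕ Fin r) (Fin n ⊕ Fin r) (RatFunc F)) (hP : ∀ j, P (Sum.inr j) = 0) :
    ∃ (P' Q' : Matrix (Fin n ⊕ Fin r) (Fin n ⊕ Fin r) (Polynomial F)) (m : ℕ) (b : Polynomial F),
      (∀ j, P' (Sum.inr j) = 0) ∧ b.eval 0 ≠ 0 ∧
      MvPolynomial.C (algebraMap (Polynomial F) (RatFunc F) (Polynomial.X ^ m * b)) * symDet P Q =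
        MvPolynomial.map (algebraMap (Polynomial F) (RatFunc F)) (symDet P' Q') := by
  obtain ⟨c, hc⟩ := IsLocalization.exist_integer_multiples_of_finite
    (nonZeroDivisors (Polynomial F))
    (fun x : (Fin n ⊕ Fin r) × (Fin n ⊕ Fin r) × Bool =>
      if x.2.2 then P x.1 x.2.1 else Q x.1 x.2.1)
  have h1 : ∀ i j, ∃ g : Polynomial F, algebraMap (Polynomial F) (RatFunc F) g =
      algebraMap (Polynomial F) (RatFunc F) c * P i j := by
    intro i j
    obtain ⟨g, hg⟩ := hc (i, j, true)
    exact ⟨g, by rw [hg]; simp [Algebra.smul_def]⟩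
  have h2 : ∀ i j, ∃ g : Polynomial F, algebraMap (Polynomial F) (RatFunc F) g =
      algebraMap (Polynomial F) (RatFunc F) c * Q i j := by
    intro i j
    obtain ⟨g, hg⟩ := hc (i, j, false)
    exact ⟨g, by rw [hg]; simp [Algebra.smul_def]⟩
  choose P' hP' using h1
  choose Q' hQ' using h2
  have hc0 : (c : Polynomial F) ^ (n + r) ≠ 0 := pow_ne_zero _ (nonZeroDivisors.ne_zero c.2)
  obtain ⟨b, hb, hb'⟩ := Polynomial.exists_eq_pow_rootMultiplicity_mul_and_not_dvd _ hc0 0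
  rw [map_zero, sub_zero] at hb hb'
  refine ⟨Matrix.of P', Matrix.of Q', ((c : Polynomial F) ^ (n + r)).rootMultiplicity 0, b, ?_, ?_, ?_⟩
  · intro j
    ext1 k
    apply RatFunc.algebraMap_injective F
    simp [hP', hP]
  · rwa [Polynomial.X_dvd_iff, Polynomial.coeff_zero_eq_eval_zero] at hb'
  · rw [← hb, map_symDet, map_pow, ← symDet_smul]
    congr 1
    · ext1 i j
      simp [hP']
    · ext1 i j
      simp [hQ']

theorem symDet_final {F : Type*} [Field F] {n r : ℕ}
    (P Q : Matrix (Fin n ⊕ Fin r) (Fin n ⊕ Fin r) F) (hP : ∀ j, P (Sum.inr j) = 0) (u : F)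
    (hu : u ≠ 0) (hr : r ≠ 0) :
    ∃ (P' Q' : Matrix (Fin n ⊕ Fin r) (Fin n ⊕ Fin r) F), (∀ i, P' (Sum.inl i) ≠ 0) ∧
      MvPolynomial.C u * symDet P' Q' = symDet P Q := by
  let z : Fin r := ⟨0, Nat.pos_of_ne_zero hr⟩
  by_cases h0 : symDet P Q = 0
  · refine ⟨1, 0, fun i h => ?_, ?_⟩
    · have := congrFun h (Sum.inl i)
      simp at this
    · rw [h0, symDet, Matrix.det_eq_zero_of_row_eq_zero (Sum.inr z), mul_zero]
      intro j
      simp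
  have hQz : Q (Sum.inr z) ≠ 0 := by
    intro hq
    apply h0
    rw [symDet, Matrix.det_eq_zero_of_row_eq_zero (Sum.inr z)]
    intro j
    simp [hq]
  let P1 : Matrix (Fin n ⊕ Fin r) (Fin n ⊕ Fin r) F := Matrix.of fun i =>
    Sum.elim (fun i => if P (Sum.inl i) = 0 then Q (Sum.inr z) else P (Sum.inl i)) 0 i
  have e1 : symDet P1 Q = symDet P Q := by
    rw [symDet, symDet]
    refine Matrix.det_eq_of_forall_row_eq_smul_add_const
      (Sum.elim (fun i => if P (Sum.inl i) = 0 then MvPolynomial.X i else 0) 0) (Sum.inr z)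
      (by simp) ?_
    intro i j
    rcases i with i | i
    · by_cases hi : P (Sum.inl i) = 0
      · simp [P1, hi]
      · simp [P1, hi]
    · simp [P1, hP]
  let d : Fin n ⊕ Fin r → F := Function.update 1 (Sum.inr z) u⁻¹
  refine ⟨P1, Matrix.of fun i j => d i * Q i j, ?_, ?_⟩
  · intro i
    by_cases hi : P (Sum.inl i) = 0
    · have : P1 (Sum.inl i) = Q (Sum.inr z) := by ext1 j; simp [P1, hi]
      rwa [this]
    · have : P1 (Sum.inl i) = P (Sum.inl i) := by ext1 j; simp [P1, hi]
      rwa [this]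
  · have := symDet_mul P1 Q P1 (Matrix.of fun i j => d i * Q i j) 1 d 1 ?_ ?_
    · have hd : ∏ i, d i = u⁻¹ := by
        simp only [d]
        rw [Finset.prod_update_of_mem (Finset.mem_univ _)]
        simp
      simp only [Pi.one_apply, Finset.prod_const_one, map_one, mul_one, Matrix.det_one, hd, e1]
        at this
      rw [this, ← mul_assoc, ← map_mul, mul_inv_cancel₀ hu, map_one, one_mul]
    · intro i j
      rcases i with i | i
      · simp [d]
      · simp [P1]
    · intro i j
      simp

/-- Main closure theorem, affine case: if A_0, A_1, …, A_n ∈ F(ε)^{r×r} with each A_i (i ≥ 1)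
of rank one, and the coefficientwise limit f = lim_{ε→0} det(A_0 + Σ A_i x_i) exists, then
there are B_0, B_1, …, B_n ∈ F^{(n+r)×(n+r)} with each B_i (i ≥ 1) of rank one and
f = det(B_0 + Σ B_i x_i). -/
theorem border_rank_one_det_closed_affine {F : Type*} [Field F] {r n : ℕ}
    (A0 : Matrix (Fin r) (Fin r) (RatFunc F))
    (A : Fin n → Matrix (Fin r) (Fin r) (RatFunc F)) (hA : ∀ i, (A i).rank = 1)
    (hlim : ∀ d : (Fin n) →₀ ℕ,
      rfHasLim (MvPolynomial.coeff d
        (A0.map (MvPolynomial.C : RatFunc F →+* _) +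
          ∑ i : Fin n, (X i : MvPolynomial (Fin n) (RatFunc F)) •
            ((A i).map (MvPolynomial.C : RatFunc F →+* _))).det)) :
    ∃ (B0 : Matrix (Fin (n + r)) (Fin (n + r)) F)
      (B : Fin n → Matrix (Fin (n + r)) (Fin (n + r)) F),
      (∀ i, (B i).rank = 1) ∧
      ∀ d : (Fin n) →₀ ℕ,
        rfLim (MvPolynomial.coeff d
          (A0.map (MvPolynomial.C : RatFunc F →+* _) +
            ∑ i : Fin n, (X i : MvPolynomial (Fin n) (RatFunc F)) •
              ((A i).map (MvPolynomial.C : RatFunc F →+* _))).det) =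
        MvPolynomial.coeff d
          (B0.map (MvPolynomial.C : F →+* _) +
            ∑ i : Fin n, (X i : MvPolynomial (Fin n) F) •
              ((B i).map (MvPolynomial.C : F →+* _))).det := by
  by_cases hr : r = 0
  · have hn : n = 0 := by
      by_contra hn
      have := hA ⟨0, Nat.pos_of_ne_zero hn⟩
      have h2 := Matrix.rank_le_card_width (A ⟨0, Nat.pos_of_ne_zero hn⟩)
      simp [hr] at h2
      omega
    subst hr
    subst hn
    refine ⟨0, fun i => i.elim0, fun i => i.elim0, fun d => ?_⟩
    haveI : IsEmpty (Fin (0 + 0)) := Fin.isEmpty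
    rw [Matrix.det_isEmpty, Matrix.det_isEmpty, Subsingleton.elim d 0]
    simp [rfLim]
  obtain ⟨P, Q, hP, hf⟩ := symDet_initial A0 A hA
  rw [← hf] at hlim ⊢
  obtain ⟨P1, Q1, m, b, hP1, hb, h1⟩ := symDet_clear P Q hP
  obtain ⟨P2, Q2, u, hu, hP2, h2⟩ := symDet_limit _ hlim m P1 Q1 b hP1 hb h1
  obtain ⟨P3, Q3, hP3, h3⟩ := symDet_final P2 Q2 hP2 u hu hr
  obtain ⟨B0, B, hB, h4⟩ := symDet_realize P3 Q3 hP3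
  refine ⟨B0, B, hB, fun d => ?_⟩
  rw [← h4]
  apply mul_left_cancel₀ hu
  rw [h2, ← h3, MvPolynomial.coeff_C_mul]
end
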